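/- Let B be the adjacency matrix of a simple graph H on n vertices, and suppose det(W) ≠ 0. Then A and B have the same characteristic polynomial and J − I − A and J − I − B have the same characteristic polynomial (J the all-one matrix) if and only if there exists an n×n rational orthogonal matrix Q (QᵀQ = I over ℚ) with Qe = e and Qᵀ A Q = B. -/

import Mathlib

open Matrix

/-- The **matrix determinant lemma** over a domain, stated with the adjugate. -/
theorem det_add_vecMulVec_of_det_ne_zero {R ι : Type*} [CommRing R] [IsDomain R] [Fintype ι]
    [DecidableEq ι] (M : Matrix ι ι R) (h : M.det ≠ 0) (u v : ι → R) :
    (M + vecMulVec u v).det = M.det + v ⬝ᵥ (M.adjugate *ᵥ u) := by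
  have hinj := IsFractionRing.injective R (FractionRing R)
  apply hinj
  set f := algebraMap R (FractionRing R)
  have hdet : (M.map f).det ≠ 0 := by
    rw [← RingHom.mapMatrix_apply, ← RingHom.map_det]
    exact fun h0 => h (hinj (by rw [h0, map_zero]))
  have key := det_add_replicateCol_mul_replicateRow (ι := Unit) (A := M.map f)
    (isUnit_iff_ne_zero.mpr hdet) (f ∘ u) (f ∘ v)
  have hsum : f.mapMatrix (M + vecMulVec u v)
      = M.map f + replicateCol Unit (f ∘ u) * replicateRow Unit (f ∘ v) := by
    ext i j
    simp [vecMulVec_apply, Matrix.mul_apply]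
  have hadj : f (v ⬝ᵥ (M.adjugate *ᵥ u)) = (f ∘ v) ⬝ᵥ ((M.map f).adjugate *ᵥ (f ∘ u)) := by
    have hmulVec : f ∘ (M.adjugate *ᵥ u) = M.adjugate.map f *ᵥ (f ∘ u) :=
      funext fun i => RingHom.map_mulVec f _ _ i
    rw [RingHom.map_dotProduct, hmulVec, ← RingHom.mapMatrix_apply,
      ← RingHom.mapMatrix_apply, RingHom.map_adjugate]
  have hinner : replicateRow Unit (f ∘ v) * (M.map f)⁻¹ * replicateCol Unit (f ∘ u)
      = replicateRow Unit (fun _ : Unit =>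
        (M.map f).det⁻¹ * ((f ∘ v) ⬝ᵥ ((M.map f).adjugate *ᵥ (f ∘ u)))) := by
    ext i j
    rw [Matrix.mul_assoc, ← replicateCol_mulVec, replicateRow_mul_replicateCol_apply,
      Matrix.inv_def, Ring.inverse_eq_inv', smul_mulVec, dotProduct_smul, smul_eq_mul]
    rfl
  rw [RingHom.map_det, hsum, key, map_add, hadj, hinner, RingHom.map_det,
    RingHom.mapMatrix_apply, det_unique (n := Unit)]
  simp only [Matrix.add_apply, one_apply_eq, replicateRow_apply]
  field_simp

section

open Polynomial

/-- Entries of `adjugate (X - M)` have degree less than `n`. -/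
theorem coeff_adjugate_charmatrix_eq_zero {R : Type*} [CommRing R] {n : ℕ}
    (M : Matrix (Fin n) (Fin n) R) (i j : Fin n) :
    (M.charmatrix.adjugate i j).coeff n = 0 := by
  obtain _ | m := n
  · exact i.elim0
  rw [adjugate_fin_succ_eq_det_submatrix]
  have hsub : M.charmatrix.submatrix j.succAbove i.succAbove
      = (X : R[X]) • ((1 : Matrix _ _ R).submatrix j.succAbove i.succAbove).map C
        + ((-M).submatrix j.succAbove i.succAbove).map C := by
    ext1 a b
    simp [charmatrix_apply, Matrix.one_apply, diagonal_apply, sub_eq_add_neg, apply_ite C]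
  have hdeg := natDegree_det_X_add_C_le
    ((1 : Matrix _ _ R).submatrix j.succAbove i.succAbove)
    ((-M).submatrix j.succAbove i.succAbove)
  rw [← hsub, Fintype.card_fin] at hdeg
  apply coeff_eq_zero_of_natDegree_lt
  have hC : ((-1 : R[X]) ^ (j + i : ℕ)) = C ((-1) ^ (j + i : ℕ)) := by simp
  rw [hC]
  exact (natDegree_C_mul_le _ _).trans_lt (by omega)

/-- The polynomial `eᵀ adj(X - M) Mᵏ e`. -/
noncomputable def adjugateMoment {n : ℕ} (M : Matrix (Fin n) (Fin n) ℤ) (k : ℕ) : ℤ[X] :=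
  1 ⬝ᵥ (M.charmatrix.adjugate *ᵥ ((C : ℤ →+* ℤ[X]) ∘ (M ^ k *ᵥ 1)))

theorem coeff_adjugateMoment {n : ℕ} (M : Matrix (Fin n) (Fin n) ℤ) (k : ℕ) :
    (adjugateMoment M k).coeff n = 0 := by
  simp only [adjugateMoment, dotProduct, mulVec, Pi.one_apply, one_mul, finsetSum_coeff,
    Function.comp_apply, coeff_mul_C, coeff_adjugate_charmatrix_eq_zero, zero_mul,
    Finset.sum_const_zero]

theorem adjugateMoment_succ {n : ℕ} (M : Matrix (Fin n) (Fin n) ℤ) (k : ℕ) :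
    adjugateMoment M (k + 1)
      = X * adjugateMoment M k - M.charpoly * C (1 ⬝ᵥ (M ^ k *ᵥ 1)) := by
  set v : Fin n → ℤ := M ^ k *ᵥ 1 with hv
  have hstep : (C : ℤ →+* ℤ[X]) ∘ (M ^ (k + 1) *ᵥ 1)
      = (X : ℤ[X]) • (C ∘ v) - M.charmatrix *ᵥ (C ∘ v) := by
    rw [pow_succ', ← mulVec_mulVec, ← hv, charmatrix, sub_mulVec]
    ext1 i
    simp [mulVec, dotProduct]
  rw [adjugateMoment, hstep, mulVec_sub, mulVec_mulVec, adjugate_mul, mulVec_smul, smul_mulVec,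
    one_mulVec, dotProduct_sub, dotProduct_smul, dotProduct_smul, smul_eq_mul, smul_eq_mul,
    adjugateMoment, ← hv, charpoly]
  simp [dotProduct]

theorem moment_eq_coeff_adjugateMoment {n : ℕ} (hn : 0 < n) (M : Matrix (Fin n) (Fin n) ℤ)
    (k : ℕ) : 1 ⬝ᵥ (M ^ k *ᵥ 1) = (adjugateMoment M k).coeff (n - 1) := by
  obtain ⟨m, rfl⟩ : ∃ m, n = m + 1 := ⟨n - 1, by omega⟩
  have h := congrArg (fun p : ℤ[X] => p.coeff (m + 1)) (adjugateMoment_succ M k)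
  have hlead : M.charpoly.coeff (m + 1) = 1 := by
    have := M.charpoly_monic.coeff_natDegree
    rwa [charpoly_natDegree_eq_dim, Fintype.card_fin] at this
  simp only [coeff_adjugateMoment, coeff_sub, coeff_X_mul, coeff_mul_C, hlead, one_mul] at h
  simpa using (sub_eq_zero.mp h.symm).symm

theorem charpoly_compl_comp {n : ℕ} (M : Matrix (Fin n) (Fin n) ℤ) :
    ((Matrix.of fun _ _ => (1 : ℤ)) - 1 - M).charpoly.comp (-X - 1)
      = (-1) ^ n * (M.charpoly + adjugateMoment M 0) := by
  have hM : M.charmatrix.det ≠ 0 := M.charpoly_monic.ne_zero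
  have hadj : adjugateMoment M 0 = 1 ⬝ᵥ (M.charmatrix.adjugate *ᵥ 1) := by
    rw [adjugateMoment, pow_zero, one_mulVec]
    congr 2
  rw [hadj, charpoly, charpoly, ← det_add_vecMulVec_of_det_ne_zero _ hM, ← coe_compRingHom_apply,
    RingHom.map_det]
  have hneg := det_neg (M.charmatrix + vecMulVec 1 1)
  rw [Fintype.card_fin] at hneg
  rw [← hneg]
  congr 1
  ext1 i j
  by_cases hij : i = j
  · subst hij
    simp
    ring
  · simp [hij]
    ring

/-- Cospectral matrices with cospectral complements have the same walk counts. -/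
theorem moment_eq_of_charpoly_eq {n : ℕ} (hn : 0 < n) {A B : Matrix (Fin n) (Fin n) ℤ}
    (h : A.charpoly = B.charpoly)
    (hc : ((Matrix.of fun _ _ => (1 : ℤ)) - 1 - A).charpoly
      = ((Matrix.of fun _ _ => (1 : ℤ)) - 1 - B).charpoly) (k : ℕ) :
    (1 : Fin n → ℤ) ⬝ᵥ (A ^ k *ᵥ 1) = 1 ⬝ᵥ (B ^ k *ᵥ 1) := by
  have hr : ∀ k, adjugateMoment A k = adjugateMoment B k := by
    intro k
    induction k with
    | zero =>
      have h0 := congrArg (fun p : ℤ[X] => p.comp (-X - 1)) hc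
      simp only [charpoly_compl_comp, h] at h0
      exact add_left_cancel (mul_left_cancel₀ (pow_ne_zero n (by simp)) h0)
    | succ k ih =>
      rw [adjugateMoment_succ, adjugateMoment_succ, moment_eq_coeff_adjugateMoment hn,
        moment_eq_coeff_adjugateMoment hn, ih, h]
  rw [moment_eq_coeff_adjugateMoment hn, moment_eq_coeff_adjugateMoment hn, hr]

end

/-- The walk-matrix `[e, Me, …, Mⁿ⁻¹e]`. -/
def walkMatrix {n : ℕ} (M : Matrix (Fin n) (Fin n) ℤ) : Matrix (Fin n) (Fin n) ℤ :=
  Matrix.of fun i j => (M ^ (j : ℕ) *ᵥ 1) i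

theorem walkMatrix_transpose_mul_pow_mul {n : ℕ} {M : Matrix (Fin n) (Fin n) ℤ} (hM : Mᵀ = M)
    (k : ℕ) (i j : Fin n) :
    ((walkMatrix M)ᵀ * M ^ k * walkMatrix M) i j
      = 1 ⬝ᵥ (M ^ ((i : ℕ) + k + (j : ℕ)) *ᵥ 1) := by
  have hrow : (walkMatrix M)ᵀ i = (1 : Fin n → ℤ) ᵥ* M ^ (i : ℕ) := by
    rw [← mulVec_transpose, transpose_pow, hM]
    rfl
  have hcol : (fun l => walkMatrix M l j) = M ^ (j : ℕ) *ᵥ 1 := rfl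
  rw [Matrix.mul_assoc, Matrix.mul_apply_eq_vecMul, hrow, vecMul_vecMul, ← Matrix.mul_assoc,
    ← pow_add, ← vecMul_vecMul]
  change ((1 : Fin n → ℤ) ᵥ* M ^ ((i : ℕ) + k)) ⬝ᵥ (fun l => walkMatrix M l j) = _
  rw [hcol, ← dotProduct_mulVec, mulVec_mulVec, ← pow_add]

theorem exists_orthogonal_of_moment_eq {n : ℕ} (hn : 0 < n) {A B : Matrix (Fin n) (Fin n) ℤ}
    (hA : Aᵀ = A) (hB : Bᵀ = B) (hdet : (walkMatrix A).det ≠ 0)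
    (h : ∀ k, (1 : Fin n → ℤ) ⬝ᵥ (A ^ k *ᵥ 1) = 1 ⬝ᵥ (B ^ k *ᵥ 1)) :
    ∃ Q : Matrix (Fin n) (Fin n) ℚ, Qᵀ * Q = 1 ∧
      Q.mulVec (fun _ => (1 : ℚ)) = (fun _ => (1 : ℚ)) ∧
      Qᵀ * A.map (Int.cast : ℤ → ℚ) * Q = B.map (Int.cast : ℤ → ℚ) := by
  have hgram (k : ℕ) : (walkMatrix A)ᵀ * A ^ k * walkMatrix A
      = (walkMatrix B)ᵀ * B ^ k * walkMatrix B := by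
    ext1 i j
    rw [walkMatrix_transpose_mul_pow_mul hA, walkMatrix_transpose_mul_pow_mul hB, h]
  have hgram0 : (walkMatrix A)ᵀ * walkMatrix A = (walkMatrix B)ᵀ * walkMatrix B := by
    simpa using hgram 0
  have hgram1 : (walkMatrix A)ᵀ * A * walkMatrix A = (walkMatrix B)ᵀ * B * walkMatrix B := by
    simpa using hgram 1
  have hdetB : (walkMatrix B).det ≠ 0 := by
    intro h0
    have := congrArg Matrix.det hgram0
    simp [det_mul, h0, hdet] at this
  let f := (Int.castRingHom ℚ).mapMatrix (m := Fin n)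
  set U := f (walkMatrix A)
  set V := f (walkMatrix B) with hV
  have hmapT (M : Matrix (Fin n) (Fin n) ℤ) : f Mᵀ = (f M)ᵀ := rfl
  have hUV : Uᵀ * U = Vᵀ * V := by
    simpa only [map_mul, hmapT] using congrArg f hgram0
  have hUV1 : Uᵀ * f A * U = Vᵀ * f B * V := by
    simpa only [map_mul, hmapT] using congrArg f hgram1
  have hVdet : IsUnit V.det := by
    rw [hV, ← RingHom.map_det, isUnit_iff_ne_zero]
    simpa using hdetB
  have hVTdet : IsUnit Vᵀ.det := by rwa [det_transpose]
  have hfirst (M : Matrix (Fin n) (Fin n) ℤ) :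
      f (walkMatrix M) *ᵥ Pi.single ⟨0, hn⟩ 1 = fun _ => (1 : ℚ) := by
    ext i
    simp [f, walkMatrix]
  refine ⟨U * V⁻¹, ?_, ?_, ?_⟩
  · rw [transpose_mul, transpose_nonsing_inv, Matrix.mul_assoc, ← Matrix.mul_assoc Uᵀ, hUV,
      Matrix.mul_assoc, mul_nonsing_inv _ hVdet, Matrix.mul_one, nonsing_inv_mul _ hVTdet]
  · rw [← hfirst B, ← hV, mulVec_mulVec, nonsing_inv_mul_cancel_right _ _ hVdet, hfirst A,
      ← hfirst B]
  · change (U * V⁻¹)ᵀ * f A * (U * V⁻¹) = f B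
    calc (U * V⁻¹)ᵀ * f A * (U * V⁻¹) = Vᵀ⁻¹ * (Uᵀ * f A * U) * V⁻¹ := by
          rw [transpose_mul, transpose_nonsing_inv]
          simp only [Matrix.mul_assoc]
      _ = (Vᵀ⁻¹ * Vᵀ) * f B * (V * V⁻¹) := by
          rw [hUV1]
          simp only [Matrix.mul_assoc]
      _ = f B := by
          rw [mul_nonsing_inv _ hVdet, nonsing_inv_mul _ hVTdet, Matrix.mul_one, Matrix.one_mul]

theorem charpoly_eq_of_orthogonal_conj {n : ℕ} {A B : Matrix (Fin n) (Fin n) ℤ}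
    {Q : Matrix (Fin n) (Fin n) ℚ} (hQ : Qᵀ * Q = 1)
    (h : Qᵀ * A.map (Int.cast : ℤ → ℚ) * Q = B.map (Int.cast : ℤ → ℚ)) :
    A.charpoly = B.charpoly := by
  apply Polynomial.map_injective (Int.castRingHom ℚ) Int.cast_injective
  rw [← charpoly_map, ← charpoly_map]
  change (A.map (Int.cast : ℤ → ℚ)).charpoly = (B.map (Int.cast : ℤ → ℚ)).charpoly
  rw [← h, charpoly_mul_comm, ← Matrix.mul_assoc, mul_eq_one_comm.mp hQ, Matrix.one_mul]

theorem orthogonal_conj_compl {n : ℕ} {A B : Matrix (Fin n) (Fin n) ℤ}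
    {Q : Matrix (Fin n) (Fin n) ℚ} (hQ : Qᵀ * Q = 1)
    (he : Q.mulVec (fun _ => (1 : ℚ)) = (fun _ => (1 : ℚ)))
    (h : Qᵀ * A.map (Int.cast : ℤ → ℚ) * Q = B.map (Int.cast : ℤ → ℚ)) :
    Qᵀ * ((Matrix.of fun _ _ => (1 : ℤ)) - 1 - A).map (Int.cast : ℤ → ℚ) * Q
      = ((Matrix.of fun _ _ => (1 : ℤ)) - 1 - B).map (Int.cast : ℤ → ℚ) := by
  have hmap (M : Matrix (Fin n) (Fin n) ℤ) :
      ((Matrix.of fun _ _ => (1 : ℤ)) - 1 - M).map (Int.cast : ℤ → ℚ)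
        = vecMulVec (fun _ => 1) (fun _ => 1) - 1 - M.map (Int.cast : ℤ → ℚ) := by
    ext i j
    by_cases hij : i = j <;> simp [hij, vecMulVec_apply]
  have heT : Qᵀ *ᵥ (fun _ => (1 : ℚ)) = fun _ => 1 := by
    conv_lhs => rw [← he]
    rw [mulVec_mulVec, hQ, one_mulVec]
  rw [hmap, hmap, Matrix.mul_sub, Matrix.mul_sub, Matrix.sub_mul, Matrix.sub_mul, h,
    Matrix.mul_one, hQ, mul_vecMulVec, vecMulVec_mul, ← mulVec_transpose, heT]

/-- For a controllable graph `G`, a graph `H` is cospectral with `G`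
with cospectral complements iff there is a rational orthogonal matrix `Q` with
`Qe = e` and `QᵀAQ = B`. -/
theorem stmt_1 (n : ℕ) (hn : 0 < n)
    (A : Matrix (Fin n) (Fin n) ℤ)
    (hA_symm : Aᵀ = A)
    (hA_diag : ∀ i, A i i = 0)
    (hA_01 : ∀ i j, A i j = 0 ∨ A i j = 1)
    (W : Matrix (Fin n) (Fin n) ℤ)
    (hW : W = Matrix.of fun (i j : Fin n) => (A ^ (j : ℕ)).mulVec (fun _ => (1 : ℤ)) i)
    (hdet : W.det ≠ 0)
    (B : Matrix (Fin n) (Fin n) ℤ)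
    (hB_symm : Bᵀ = B)
    (hB_diag : ∀ i, B i i = 0)
    (hB_01 : ∀ i j, B i j = 0 ∨ B i j = 1) :
    (A.charpoly = B.charpoly ∧
      ((Matrix.of fun _ _ => (1 : ℤ)) - 1 - A).charpoly
        = ((Matrix.of fun _ _ => (1 : ℤ)) - 1 - B).charpoly)
    ↔ (∃ Q : Matrix (Fin n) (Fin n) ℚ, Qᵀ * Q = 1 ∧
        Q.mulVec (fun _ => (1 : ℚ)) = (fun _ => (1 : ℚ)) ∧
        Qᵀ * A.map (Int.cast : ℤ → ℚ) * Q = B.map (Int.cast : ℤ → ℚ)) := by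
  have hWA : W = walkMatrix A := hW
  constructor
  · rintro ⟨h, hc⟩
    exact exists_orthogonal_of_moment_eq hn hA_symm hB_symm (hWA ▸ hdet)
      (moment_eq_of_charpoly_eq hn h hc)
  · rintro ⟨Q, hQ, he, h⟩
    exact ⟨charpoly_eq_of_orthogonal_conj hQ h,
      charpoly_eq_of_orthogonal_conj hQ (orthogonal_conj_compl hQ he h)⟩
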